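/- Let E be the elliptic curve given by Y² = X³ + X + 1, and let K be a number field with [K : ℚ] ≤ 2. Then the group E(K) of K-rational points of E has trivial torsion subgroup: every point of E(K) of finite order is the point at infinity O. -/

import Mathlib

open WeierstrassCurve
open Polynomial

theorem aux_deg {K : Type*} [Field K] [NumberField K] (hdeg : Module.finrank ℚ K ≤ 2)
    (p : ℤ[X]) (hm : p.Monic) (hi : Irreducible p) (hd : 3 ≤ p.natDegree) (x : K)
    (hx : aeval x p = 0) : False := by
  have h1 := (hm.irreducible_iff_irreducible_map_fraction_map (K := ℚ)).1 hi
  have h2 := minpoly.eq_of_irreducible_of_monic h1 (x := x) (by rw [aeval_map_algebraMap]; exact hx) (hm.map _)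
  have h3 := minpoly.natDegree_le (A := ℚ) x
  rw [← h2, hm.natDegree_map] at h3
  omega

theorem aux_two {K : Type*} [Field K] [NumberField K] (hdeg : Module.finrank ℚ K ≤ 2) (x : K)
    (hx : x ^ 3 + x + 1 = 0) : False := by
  have hm : (X ^ 3 + X + 1 : ℤ[X]).Monic := by monicity!
  have hn : (X ^ 3 + X + 1 : ℤ[X]).natDegree = 3 := by compute_degree!
  refine aux_deg hdeg (X ^ 3 + X + 1) hm ?_ hn.ge x (by simpa using hx)
  have hdec : ∀ a : ZMod 2, ¬ (a ^ 3 + a + 1 = 0) := by decide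
  have : Fact (Nat.Prime 2) := ⟨Nat.prime_two⟩
  refine hm.irreducible_of_irreducible_map (Int.castRingHom (ZMod 2)) _ ?_
  have hn' : (map (Int.castRingHom (ZMod 2)) (X ^ 3 + X + 1 : ℤ[X])).natDegree = 3 := by
    rw [hm.natDegree_map, hn]
  apply irreducible_of_degree_le_three_of_not_isRoot
  · rw [hn']; decide
  · intro a
    simp only [IsRoot, Polynomial.map_add, Polynomial.map_pow, map_X, Polynomial.map_one, eval_add,
      eval_pow, eval_X, eval_one]
    exact hdec a

theorem aux_three {K : Type*} [Field K] [NumberField K] (hdeg : Module.finrank ℚ K ≤ 2) (x : K)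
    (hx : 3 * x ^ 4 + 6 * x ^ 2 + 12 * x - 1 = 0) : False := by
  have hm : (X ^ 4 - 12 * X ^ 3 - 6 * X ^ 2 - 3 : ℤ[X]).Monic := by monicity!
  have hn : (X ^ 4 - 12 * X ^ 3 - 6 * X ^ 2 - 3 : ℤ[X]).natDegree = 4 := by compute_degree!
  have hx0 : x ≠ 0 := by
    rintro rfl
    norm_num at hx
  refine aux_deg hdeg _ hm ?_ (by omega) x⁻¹ ?_
  · have h3 : Prime (3 : ℤ) := Int.prime_three
    refine irreducible_of_eisenstein_criterion (P := Ideal.span {3})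
      ((Ideal.span_singleton_prime (by norm_num)).2 h3) ?_ ?_ ?_ ?_ hm.isPrimitive
    · rw [hm.leadingCoeff, Ideal.mem_span_singleton]; norm_num
    · intro n hnn
      rw [degree_eq_natDegree hm.ne_zero, hn] at hnn
      have : n < 4 := by exact_mod_cast hnn
      have e : (X ^ 4 - 12 * X ^ 3 - 6 * X ^ 2 - 3 : ℤ[X]) = X ^ 4 + C 3 * (- C 4 * X ^ 3 - C 2 * X ^ 2 - 1) := by
        simp only [map_ofNat]; ring
      rw [Ideal.mem_span_singleton, e, coeff_add, coeff_X_pow, if_neg (by omega), zero_add, coeff_C_mul]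
      exact dvd_mul_right _ _
    · rw [degree_eq_natDegree hm.ne_zero, hn]; norm_num
    · rw [Ideal.span_singleton_pow, Ideal.mem_span_singleton]
      simp [coeff_zero_eq_eval_zero]
  · simp only [map_sub, map_pow, aeval_X, map_mul, map_ofNat]
    field_simp
    linear_combination -hx

theorem aux_quad {K : Type*} [Field K] [NumberField K] (hdeg : Module.finrank ℚ K ≤ 2) (x : K) :
    ∃ a b c : ℤ, a * x ^ 2 + b * x + c = 0 ∧ ¬ (3 ∣ a ∧ 3 ∣ b ∧ 3 ∣ c) := by
  have hint : IsIntegral ℚ x := Algebra.IsIntegral.isIntegral x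
  set q := minpoly ℚ x
  have hq : q ≠ 0 := minpoly.ne_zero hint
  set r := IsLocalization.integerNormalization (nonZeroDivisors ℤ) q with hr
  have hr0 : r ≠ 0 := by
    intro h
    exact hq ((IsLocalization.integerNormalization_eq_zero_iff le_rfl q).1 h)
  have hrx : aeval x r = 0 :=
    IsLocalization.integerNormalization_aeval_eq_zero (nonZeroDivisors ℤ) q (minpoly.aeval ℚ x)
  have hrd : r.natDegree ≤ 2 := by
    have h1 : r.natDegree ≤ q.natDegree := by
      obtain ⟨d, hd, hdq⟩ := IsLocalization.integerNormalization_spec (nonZeroDivisors ℤ) q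
      rw [← natDegree_map_eq_of_injective (algebraMap ℤ ℚ).injective_int, hdq]
      exact natDegree_smul_le _ _
    exact h1.trans ((minpoly.natDegree_le (A := ℚ) x).trans hdeg)
  have hp := r.isPrimitive_primPart
  have hpx : aeval x r.primPart = 0 := aeval_primPart_eq_zero hr0 hrx
  have hpd : r.primPart.natDegree < 3 := by rw [natDegree_primPart]; omega
  set p := r.primPart
  refine ⟨p.coeff 2, p.coeff 1, p.coeff 0, ?_, ?_⟩
  · rw [aeval_eq_sum_range' hpd] at hpx
    simp only [Finset.sum_range_succ, Finset.sum_range_zero, zsmul_eq_mul] at hpx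
    linear_combination hpx
  · rintro ⟨h2, h1, h0⟩
    have : IsUnit (3 : ℤ) := by
      apply hp
      rw [C_dvd_iff_dvd_coeff]
      intro i
      match i with
      | 0 => exact h0
      | 1 => exact h1
      | 2 => exact h2
      | n + 3 => rw [coeff_eq_zero_of_natDegree_lt (by omega)]; exact dvd_zero _
    rw [Int.isUnit_iff] at this
    omega

theorem aux_F9 {k : Type*} [Field k] (h3 : (3 : k) = 0) (x : k) (a b c : ℤ)
    (h : a * x ^ 2 + b * x + c = 0) (habc : ¬ (3 ∣ a ∧ 3 ∣ b ∧ 3 ∣ c)) : x ^ 9 = x := by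
  have h3' : ((3 : ℤ) : k) = 0 := by exact_mod_cast h3
  have key : ∀ n : ℤ, (3 ∣ n ∧ (n : k) = 0) ∨ (n : k) = 1 ∨ (n : k) = -1 := by
    intro n
    obtain h | h | h : n % 3 = 0 ∨ n % 3 = 1 ∨ n % 3 = 2 := by omega
    · obtain ⟨m, rfl⟩ := Int.dvd_of_emod_eq_zero h
      left
      refine ⟨dvd_mul_right _ _, ?_⟩
      push_cast
      rw [h3, zero_mul]
    · obtain ⟨m, rfl⟩ : ∃ m, n = 3 * m + 1 := ⟨n / 3, by omega⟩
      right; left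
      push_cast
      rw [h3, zero_mul, zero_add]
    · obtain ⟨m, rfl⟩ : ∃ m, n = 3 * m - 1 := ⟨n / 3 + 1, by omega⟩
      right; right
      push_cast
      rw [h3]
      ring
  have fr : ∀ s t : k, (s + t) ^ 3 = s ^ 3 + t ^ 3 := by
    intro s t
    linear_combination (s ^ 2 * t + s * t ^ 2) * h3
  have h1 : (1 : k) ≠ 0 := one_ne_zero
  rcases key a with ⟨da, ha⟩ | ha | ha <;> rcases key b with ⟨db, hb⟩ | hb | hb <;>
    rcases key c with ⟨dc, hc⟩ | hc | hc <;> rw [ha, hb, hc] at h <;>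
    first
    | exact (habc ⟨by assumption, by assumption, by assumption⟩).elim
    | (exfalso; apply h1; linear_combination h)
    | (exfalso; apply h1; linear_combination -h)
    | (clear fr key habc; grind)

theorem aux_dbl {k : Type*} [Field k] (h3 : (3 : k) = 0) (x x2: k) (h : x ^ 9 = x)
   (hf : x^3+x+1 ≠ 0) (h2 : x2 * (4 * (x^3+x+1)) = x^4-2*x^2-8*x+1) : x2^3+x2+1=0 := by
  have hg : x^6+2*x^4+2*x^3+x^2+2*x=0 := by
    apply mul_left_cancel₀ hf
    linear_combination h +  (x^7 + x^6 + x^5 + 2 * x^4 + x^3 + x^2 + x) * h3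
  have : (x^3+x+1)^3*(x2^3+x2+1) = 0 := by
    have : x2 * (x^3+x+1) = x^4+x^2+x+1 := by
      linear_combination h2 - (x^2+3*x+x2 * (x^3+x+1))*h3
    grind
  simpa [hf] using this

/-- The curve `Y² = X³ + X + 1`. -/
abbrev EE (K : Type*) [Field K] : WeierstrassCurve.Affine K := ⟨0, 0, 0, (1 : K), (1 : K)⟩

theorem EE_eq {K : Type*} [Field K] {x y : K} (h : (EE K).Nonsingular x y) :
    y ^ 2 = x ^ 3 + x + 1 := by
  have := (WeierstrassCurve.Affine.equation_iff _ _).1 h.1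
  simpa using this

theorem EE_two {K : Type*} [Field K] [CharZero K] [DecidableEq K] {x y : K}
    (h : (EE K).Nonsingular x y) (hy : y ≠ 0) :
    ∃ x2 y2 h2, (2 : ℕ) • (Affine.Point.some x y h) = Affine.Point.some x2 y2 h2 ∧
      x2 = ((3 * x ^ 2 + 1) / (2 * y)) ^ 2 - 2 * x ∧
      y2 = - ((3 * x ^ 2 + 1) / (2 * y) * (x2 - x) + y) := by
  have hne : y ≠ (EE K).negY x y := by
    simp only [Affine.negY]
    intro h
    apply hy
    linear_combination h / 2
  rw [two_nsmul, Affine.Point.add_self_of_Y_ne hne]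
  have hs : (EE K).slope x x y y = (3 * x ^ 2 + 1) / (2 * y) := by
    rw [Affine.slope_of_Y_ne rfl hne]
    simp only [Affine.negY]
    congr 1 <;> ring
  refine ⟨_, _, _, rfl, ?_, ?_⟩
  · simp only [Affine.addX, hs]; ring
  · simp only [Affine.addY, Affine.negY, Affine.negAddY, Affine.addX, hs]; ring

theorem EE_two_zero {K : Type*} [Field K] [CharZero K] [DecidableEq K] {x y : K}
    (h : (EE K).Nonsingular x y) (hy : y = 0) : (2 : ℕ) • (Affine.Point.some x y h) = 0 := by
  rw [two_nsmul, Affine.Point.add_self_of_Y_eq]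
  simp [Affine.negY, hy]

theorem EE_dbl {K : Type*} [Field K] [CharZero K] [DecidableEq K] {x y : K}
    (h : (EE K).Nonsingular x y) (h0 : (2 : ℕ) • (Affine.Point.some x y h) ≠ 0) :
    ∃ x2 y2 h2, (2 : ℕ) • (Affine.Point.some x y h) = Affine.Point.some x2 y2 h2 ∧
      x ^ 3 + x + 1 ≠ 0 ∧
      x2 * (4 * (x ^ 3 + x + 1)) = x ^ 4 - 2 * x ^ 2 - 8 * x + 1 := by
  have hy : y ≠ 0 := fun hy => h0 (EE_two_zero h hy)
  have he := EE_eq h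
  obtain ⟨x2, y2, h2, e, hx2, -⟩ := EE_two h hy
  refine ⟨x2, y2, h2, e, ?_, ?_⟩
  · rw [← he]; exact pow_ne_zero _ hy
  · rw [hx2, ← he]
    field_simp
    linear_combination (-32 * x) * he

theorem EE_tpl {K : Type*} [Field K] [CharZero K] [DecidableEq K] {x y : K}
    (h : (EE K).Nonsingular x y) (h20 : (2 : ℕ) • (Affine.Point.some x y h) ≠ 0)
    (h30 : (3 : ℕ) • (Affine.Point.some x y h) ≠ 0) :
    ∃ x3 y3 h3, (3 : ℕ) • (Affine.Point.some x y h) = Affine.Point.some x3 y3 h3 ∧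
      3 * x ^ 4 + 6 * x ^ 2 + 12 * x - 1 ≠ 0 ∧
      x3 * (3 * x ^ 4 + 6 * x ^ 2 + 12 * x - 1) ^ 2 =
        x * (3 * x ^ 4 + 6 * x ^ 2 + 12 * x - 1) ^ 2 - 8 * (x ^ 3 + x + 1) *
          (x ^ 6 + 5 * x ^ 4 + 20 * x ^ 3 - 5 * x ^ 2 - 4 * x - 9) := by
  have hy : y ≠ 0 := fun hy => h20 (EE_two_zero h hy)
  have he := EE_eq h
  obtain ⟨x2, y2, h2, e, hx2, hy2⟩ := EE_two h hy
  have hd : (x - x2) * (4 * y ^ 2) = 3 * x ^ 4 + 6 * x ^ 2 + 12 * x - 1 := by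
    rw [hx2]
    field_simp
    linear_combination (48 * x) * he
  have e3 : (3 : ℕ) • (Affine.Point.some x y h) =
      Affine.Point.some x2 y2 h2 + Affine.Point.some x y h := by
    rw [← e]; exact succ_nsmul _ 2
  have hx : x2 ≠ x := by
    intro hx
    have hy2' : y2 = -y := by rw [hy2, hx]; ring
    apply h30
    rw [e3, Affine.Point.add_of_Y_eq hx]
    simp [Affine.negY, hy2']
  have hx' : x2 - x ≠ 0 := sub_ne_zero.2 hx
  have hpsi : 3 * x ^ 4 + 6 * x ^ 2 + 12 * x - 1 ≠ 0 := by
    rw [← hd, ← neg_sub x2 x]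
    refine mul_ne_zero (neg_ne_zero.2 hx') (by simpa using hy)
  rw [e3, Affine.Point.add_of_X_ne hx]
  refine ⟨_, _, _, rfl, hpsi, ?_⟩
  simp only [Affine.addX, zero_mul, add_zero, sub_zero]
  rw [Affine.slope_of_X_ne hx]
  have e1 : y2 - y = -((3 * x ^ 2 + 1) / (2 * y) * (x2 - x) + 2 * y) := by rw [hy2]; ring
  have e2 : (y2 - y) / (x2 - x) = - ((3 * x ^ 2 + 1) / (2 * y)) - 2 * y / (x2 - x) := by
    rw [e1]; field_simp; ring
  have e4 : x2 - x = - (3 * x ^ 4 + 6 * x ^ 2 + 12 * x - 1) / (4 * y ^ 2) := by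
    rw [← hd]; field_simp; ring
  have e5 : x2 = x - (3 * x ^ 4 + 6 * x ^ 2 + 12 * x - 1) / (4 * y ^ 2) := by
    linear_combination e4
  rw [e2, e4, e5]
  set s := 3 * x ^ 4 + 6 * x ^ 2 + 12 * x - 1 with hs
  have e6 : (-((3 * x ^ 2 + 1) / (2 * y)) - 2 * y / (-s / (4 * y ^ 2))) =
     (16 * (y ^ 2) ^ 2 - (3 * x ^ 2 + 1) * s) / (2 * y * s) := by
    field_simp
    ring
  have e7 : ((16 * (y ^ 2) ^ 2 - (3 * x ^ 2 + 1) * s) / (2 * y * s)) ^ 2 =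
     (16 * (y ^ 2) ^ 2 - (3 * x ^ 2 + 1) * s) ^ 2 / (4 * (y ^ 2) * s ^ 2) := by
    field_simp
    ring
  rw [e6, e7]
  have hy2' : y ^ 2 ≠ 0 := pow_ne_zero _ hy
  clear_value s
  generalize y ^ 2 = t at he hy2' ⊢
  field_simp
  rw [hs, he]
  ring

section val
variable {K : Type*} [Field K] {Γ : Type*} [LinearOrderedCommGroupWithZero Γ] (v : Valuation K Γ)

theorem residue_zero_iff (a : v.valuationSubring) :
    IsLocalRing.residue v.valuationSubring a = 0 ↔ v a < 1 := by
  rw [IsLocalRing.residue_eq_zero_iff, Valuation.mem_maximalIdeal_iff]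

theorem coe_num :
    ((2 : v.valuationSubring) : K) = 2 ∧
    ((3 : v.valuationSubring) : K) = 3 ∧
    ((4 : v.valuationSubring) : K) = 4 ∧
    ((5 : v.valuationSubring) : K) = 5 ∧
    ((6 : v.valuationSubring) : K) = 6 ∧
    ((8 : v.valuationSubring) : K) = 8 ∧
    ((9 : v.valuationSubring) : K) = 9 ∧
    ((12 : v.valuationSubring) : K) = 12 ∧
    ((20 : v.valuationSubring) : K) = 20 :=
  ⟨rfl, rfl, rfl, rfl, rfl, rfl, rfl, rfl, rfl⟩

theorem val_D1 {x x2 : K} (hx : 1 < v x)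
    (h : x2 * (4 * (x ^ 3 + x + 1)) = x ^ 4 - 2 * x ^ 2 - 8 * x + 1) : 1 < v x2 := by
  have hx0 : x ≠ 0 := by
    rintro rfl
    simp at hx
  have hu : v x⁻¹ < 1 := by
    rw [map_inv₀]; exact inv_lt_one_of_one_lt₀ hx
  obtain ⟨u, hu'⟩ : ∃ u : v.valuationSubring, (u : K) = x⁻¹ := ⟨⟨x⁻¹, hu.le⟩, rfl⟩
  rw [← hu'] at hu
  have hux : x * u = 1 := by rw [hu']; exact mul_inv_cancel₀ hx0
  have small : ∀ w : v.valuationSubring, v (1 + (u : K) * w) = 1 := by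
    intro w
    apply Valuation.map_one_add_of_lt
    rw [map_mul]
    exact mul_lt_one_of_lt_of_le hu w.2
  have s1 := small (-2 * u - 8 * u ^ 2 + u ^ 3)
  have s2 := small (u + u ^ 2)
  have e1 : x ^ 4 - 2 * x ^ 2 - 8 * x + 1 = x ^ 4 * (1 + (u : K) * ((-2 * u - 8 * u ^ 2 + u ^ 3 : v.valuationSubring) : K)) := by
    push_cast
    simp only [coe_num v]
    rw [hu']
    field_simp
    ring
  have e2 : x ^ 3 + x + 1 = x ^ 3 * (1 + (u : K) * ((u + u ^ 2 : v.valuationSubring) : K)) := by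
    push_cast
    rw [hu']
    field_simp
    ring
  rw [e1, e2] at h
  have h' := congrArg v h
  rw [map_mul, map_mul, map_mul, map_mul, s1, s2, mul_one, mul_one, map_pow, map_pow] at h'
  have hvx : v x ≠ 0 := (Valuation.ne_zero_iff v).2 hx0
  have h4 : v 4 ≤ 1 := (4 : v.valuationSubring).2
  have h5 : v x2 * v 4 = v x := by
    apply mul_right_cancel₀ (pow_ne_zero 3 hvx)
    rw [mul_assoc, h']
    exact pow_succ' (v x) 3
  calc 1 < v x := hx
    _ = v x2 * v 4 := h5.symm
    _ ≤ v x2 := mul_le_of_le_one_right' h4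

theorem val_D2 (h3 : v 3 < 1) {x x2 : K} (hx : v x ≤ 1) (hf : v (x ^ 3 + x + 1) < 1)
    (h : x2 * (4 * (x ^ 3 + x + 1)) = x ^ 4 - 2 * x ^ 2 - 8 * x + 1) : 1 < v x2 := by
  by_contra hc
  rw [not_lt] at hc
  obtain ⟨X, rfl⟩ : ∃ u : v.valuationSubring, (u : K) = x := ⟨⟨x, hx⟩, rfl⟩
  obtain ⟨X2, rfl⟩ : ∃ u : v.valuationSubring, (u : K) = x2 := ⟨⟨x2, hc⟩, rfl⟩
  have h3' : IsLocalRing.residue v.valuationSubring 3 = 0 := (residue_zero_iff v _).2 h3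
  have hf' : IsLocalRing.residue v.valuationSubring (X ^ 3 + X + 1) = 0 :=
    (residue_zero_iff v _).2 hf
  have h' : X2 * (4 * (X ^ 3 + X + 1)) = X ^ 4 - 2 * X ^ 2 - 8 * X + 1 := Subtype.ext h
  have h'' := congrArg (IsLocalRing.residue v.valuationSubring) h'
  simp only [map_add, map_sub, map_mul, map_pow, map_one, map_ofNat] at h'' hf' h3'
  generalize IsLocalRing.residue v.valuationSubring X = a at *
  generalize IsLocalRing.residue v.valuationSubring X2 = b at *
  apply one_ne_zero (α := IsLocalRing.ResidueField v.valuationSubring)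
  linear_combination (4 * b - a) * hf' - h'' + (a ^ 2 + 3 * a) * h3'

theorem val_D3 (h3 : v 3 < 1) {x x2 : K} (hx : v x ≤ 1) (hf : ¬ v (x ^ 3 + x + 1) < 1)
    (h : x2 * (4 * (x ^ 3 + x + 1)) = x ^ 4 - 2 * x ^ 2 - 8 * x + 1)
    (hq : ∃ a b c : ℤ, a * x ^ 2 + b * x + c = 0 ∧ ¬ (3 ∣ a ∧ 3 ∣ b ∧ 3 ∣ c)) :
    v x2 ≤ 1 ∧ v (x2 ^ 3 + x2 + 1) < 1 := by
  obtain ⟨X, rfl⟩ : ∃ u : v.valuationSubring, (u : K) = x := ⟨⟨x, hx⟩, rfl⟩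
  have hF1 : v ((X : K) ^ 3 + X + 1) = 1 :=
    le_antisymm ((v.mem_valuationSubring_iff _).1 (X ^ 3 + X + 1 : v.valuationSubring).2) (not_lt.1 hf)
  have h4 : v 4 = 1 := by
    have : (4 : K) = 1 + 3 := by norm_num
    rw [this]
    exact Valuation.map_one_add_of_lt v h3
  have hx2 : v x2 ≤ 1 := by
    have h' := congrArg v h
    rw [map_mul, map_mul, hF1, h4, mul_one, mul_one] at h'
    rw [h']
    exact (X ^ 4 - 2 * X ^ 2 - 8 * X + 1 : v.valuationSubring).2
  refine ⟨hx2, ?_⟩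
  obtain ⟨X2, rfl⟩ : ∃ u : v.valuationSubring, (u : K) = x2 := ⟨⟨x2, hx2⟩, rfl⟩
  obtain ⟨a, b, c, habc, hd⟩ := hq
  have habc' : (a : v.valuationSubring) * X ^ 2 + b * X + c = 0 := Subtype.ext (by push_cast; exact habc)
  have h3' : IsLocalRing.residue v.valuationSubring 3 = 0 := (residue_zero_iff v _).2 h3
  have hf' : IsLocalRing.residue v.valuationSubring (X ^ 3 + X + 1) ≠ 0 :=
    fun h => hf ((residue_zero_iff v _).1 h)
  have h' : X2 * (4 * (X ^ 3 + X + 1)) = X ^ 4 - 2 * X ^ 2 - 8 * X + 1 := Subtype.ext h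
  have h'' := congrArg (IsLocalRing.residue v.valuationSubring) h'
  have habc'' := congrArg (IsLocalRing.residue v.valuationSubring) habc'
  simp only [map_add, map_sub, map_mul, map_pow, map_one, map_ofNat, map_intCast, map_zero]
    at h'' hf' h3' habc''
  have := aux_dbl h3' _ _ (aux_F9 h3' _ a b c habc'' hd) hf' h''
  refine (residue_zero_iff v (X2 ^ 3 + X2 + 1)).1 ?_
  simpa only [map_add, map_pow, map_one] using this

theorem val_T (h3 : v 3 < 1) {x x3 : K} (hx : 1 < v x)
    (h : x3 * (3 * x ^ 4 + 6 * x ^ 2 + 12 * x - 1) ^ 2 =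
        x * (3 * x ^ 4 + 6 * x ^ 2 + 12 * x - 1) ^ 2 - 8 * (x ^ 3 + x + 1) *
          (x ^ 6 + 5 * x ^ 4 + 20 * x ^ 3 - 5 * x ^ 2 - 4 * x - 9)) : v x < v x3 := by
  have hx0 : x ≠ 0 := by
    rintro rfl
    simp at hx
  have hu : v x⁻¹ < 1 := by
    rw [map_inv₀]; exact inv_lt_one_of_one_lt₀ hx
  obtain ⟨u, hu'⟩ : ∃ u : v.valuationSubring, (u : K) = x⁻¹ := ⟨⟨x⁻¹, hu.le⟩, rfl⟩
  rw [← hu'] at hu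
  have small : ∀ w : v.valuationSubring, v ((u : K) * w) < 1 := by
    intro w
    rw [map_mul]
    exact mul_lt_one_of_lt_of_le hu w.2
  set s : v.valuationSubring := 3 + 6 * u ^ 2 + 12 * u ^ 3 - u ^ 4 with hs
  have hsv : v (s : K) < 1 := by
    have e : (s : K) = 3 + (u : K) * ((6 * u + 12 * u ^ 2 - u ^ 3 : v.valuationSubring) : K) := by
      rw [hs]; push_cast; simp only [coe_num v]; ring
    rw [e]
    exact Valuation.map_add_lt v h3 (small _)
  set t : v.valuationSubring := s ^ 2 - 8 * (1 + u ^ 2 + u ^ 3) *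
    (1 + 5 * u ^ 2 + 20 * u ^ 3 - 5 * u ^ 4 - 4 * u ^ 5 - 9 * u ^ 6) with ht
  have htv : v (t : K) = 1 := by
    obtain ⟨w, hw⟩ : ∃ w : v.valuationSubring, t = 1 + (u * w + (s * s + 3 * (-3))) := by
      refine ⟨-8 * ((1 + u ^ 2 + u ^ 3) *
        (5 * u + 20 * u ^ 2 - 5 * u ^ 3 - 4 * u ^ 4 - 9 * u ^ 5) + u + u ^ 2), ?_⟩
      rw [ht]; ring
    rw [hw]
    push_cast
    apply Valuation.map_one_add_of_lt
    refine Valuation.map_add_lt v (small _) (Valuation.map_add_lt v ?_ ?_)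
    · rw [map_mul]
      exact mul_lt_one_of_lt_of_le hsv s.2
    · rw [map_mul]
      exact mul_lt_one_of_lt_of_le h3 (-3 : v.valuationSubring).2
  have e1 : 3 * x ^ 4 + 6 * x ^ 2 + 12 * x - 1 = x ^ 4 * (s : K) := by
    rw [hs]
    push_cast
    simp only [coe_num v]
    rw [hu']
    field_simp
  have e2 : x * (3 * x ^ 4 + 6 * x ^ 2 + 12 * x - 1) ^ 2 - 8 * (x ^ 3 + x + 1) *
          (x ^ 6 + 5 * x ^ 4 + 20 * x ^ 3 - 5 * x ^ 2 - 4 * x - 9) = x ^ 9 * (t : K) := by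
    rw [e1, ht]
    push_cast
    simp only [coe_num v]
    have : x * (u : K) = 1 := by rw [hu']; exact mul_inv_cancel₀ hx0
    rw [hu']
    field_simp
  rw [e2, e1] at h
  have hvx : v x ≠ 0 := (Valuation.ne_zero_iff v).2 hx0
  have h' : v (x3 * (s : K) ^ 2) = v x := by
    have : x3 * (s : K) ^ 2 = x * t := by
      apply mul_right_cancel₀ (pow_ne_zero 8 hx0)
      linear_combination h
    rw [this, map_mul, htv, mul_one]
  rw [← h', map_mul]
  have hx30 : v x3 ≠ 0 := by
    intro h0
    rw [map_mul, h0, zero_mul] at h'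
    exact hvx h'.symm
  have : v ((s : K) ^ 2) < 1 := by
    rw [pow_two, map_mul]
    exact mul_lt_one_of_lt_of_le hsv s.2
  exact mul_lt_of_lt_one_right (zero_lt_iff.2 hx30) this

end val

theorem exists_val (K : Type*) [Field K] [NumberField K] :
    ∃ v : Valuation K (WithZero (Multiplicative ℤ)), v 3 < 1 := by
  have h3 : Prime (3 : ℤ) := Int.prime_three
  have hmax : (Ideal.span {(3 : ℤ)}).IsMaximal :=
    ((Ideal.span_singleton_prime (by norm_num)).2 h3).isMaximal (by simp)
  obtain ⟨Q, hQ, hQo⟩ := Ideal.exists_maximal_ideal_liesOver_of_isIntegral (S := NumberField.RingOfIntegers K)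
    (Ideal.span {(3 : ℤ)})
  have hm : (3 : NumberField.RingOfIntegers K) ∈ Q := by
    have : (3 : ℤ) ∈ Ideal.span {(3 : ℤ)} := Ideal.mem_span_singleton_self _
    rw [hQo.over, Ideal.mem_comap] at this
    simpa using this
  have hb : Q ≠ ⊥ := by
    rintro rfl
    simp at hm
  refine ⟨(⟨Q, hQ.isPrime, hb⟩ : IsDedekindDomain.HeightOneSpectrum
    (NumberField.RingOfIntegers K)).valuation K, ?_⟩
  have := (IsDedekindDomain.HeightOneSpectrum.valuation_lt_one_iff_mem (K := K)
    (⟨Q, hQ.isPrime, hb⟩ : IsDedekindDomain.HeightOneSpectrum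
      (NumberField.RingOfIntegers K)) 3).2 hm
  have e : algebraMap (NumberField.RingOfIntegers K) K 3 = 3 := map_ofNat _ 3
  rw [← e]
  exact this

theorem torsion_aux (K : Type*) [Field K] [NumberField K] [DecidableEq K]
    (hdeg : Module.finrank ℚ K ≤ 2) (q : ℕ) (hq : q.Prime) (P : (EE K).Point) (hP : P ≠ 0)
    (hqP : q • P = 0) : False := by
  have ho : addOrderOf P = q := by
    have : Fact q.Prime := ⟨hq⟩
    exact addOrderOf_eq_prime hqP hP
  have hne : ∀ m : ℕ, ¬ q ∣ m → m • P ≠ 0 := by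
    intro m hm h0
    exact hm (ho ▸ addOrderOf_dvd_of_nsmul_eq_zero h0)
  have case2 : q ≠ 2 := by
    rintro rfl
    rcases P with _ | ⟨x, y, h⟩
    · exact hP rfl
    · have he := EE_eq h
      by_cases hy : y = 0
      · apply aux_two hdeg x
        rw [← he, hy]
        simp
      · obtain ⟨x2, y2, h2, e, -⟩ := EE_two h hy
        rw [e] at hqP
        exact Affine.Point.some_ne_zero _ hqP
  have h2P : (2 : ℕ) • P ≠ 0 := hne 2 fun h => case2 ((Nat.prime_dvd_prime_iff_eq hq Nat.prime_two).1 h)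
  have case3 : q ≠ 3 := by
    rintro rfl
    rcases P with _ | ⟨x, y, h⟩
    · exact hP rfl
    · obtain ⟨x2, y2, h2, e, hf, hd⟩ := EE_dbl h h2P
      apply aux_three hdeg x
      have e3 : Affine.Point.some x2 y2 h2 = - Affine.Point.some x y h := by
        rw [← e, eq_neg_iff_add_eq_zero, ← hqP]
        exact (succ_nsmul _ 2).symm
      rw [Affine.Point.neg_some] at e3
      have hx : x2 = x := by
        injection e3
      rw [hx] at hd
      linear_combination hd
  have hq2 : ¬ q ∣ 2 := fun h => case2 ((Nat.prime_dvd_prime_iff_eq hq Nat.prime_two).1 h)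
  have hq3 : ¬ q ∣ 3 := fun h => case3 ((Nat.prime_dvd_prime_iff_eq hq Nat.prime_three).1 h)
  have hne' : ∀ m n : ℕ, m • P ≠ 0 → ¬ q ∣ n → n • (m • P) ≠ 0 := by
    intro m n hm hn
    rw [smul_smul]
    refine hne _ fun h => ?_
    rcases hq.dvd_mul.1 h with h | h
    · exact hn h
    · obtain ⟨r, rfl⟩ := h
      apply hm
      rw [mul_comm, mul_smul, hqP, smul_zero]
  obtain ⟨v, h3⟩ := exists_val K
  -- the point `4P` reduces to the point at infinity
  have h4 : ∃ x y h, (4 : ℕ) • P = Affine.Point.some x y h ∧ 1 < v x := by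
    have h22 : (2 : ℕ) • ((2 : ℕ) • P) ≠ 0 := hne' 2 2 h2P hq2
    have e4 : (4 : ℕ) • P = (2 : ℕ) • ((2 : ℕ) • P) := by rw [smul_smul]; rfl
    rw [e4]
    rcases P with _ | ⟨x, y, h⟩
    · exact (hP rfl).elim
    · obtain ⟨x2, y2, h2, e, hf, hd⟩ := EE_dbl h h2P
      rw [e] at h22 ⊢
      obtain ⟨x4, y4, h4, e', hf', hd'⟩ := EE_dbl h2 h22
      refine ⟨x4, y4, h4, e', ?_⟩
      by_cases hx : v x ≤ 1
      · by_cases hfx : v (x ^ 3 + x + 1) < 1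
        · exact val_D1 v (val_D2 v h3 hx hfx hd) hd'
        · obtain ⟨g1, g2⟩ := val_D3 v h3 hx hfx hd (aux_quad hdeg x)
          exact val_D2 v h3 g1 g2 hd'
      · exact val_D1 v (val_D1 v (not_le.1 hx) hd) hd'
  obtain ⟨x, y, h, e, hx⟩ := h4
  have hind : ∀ n : ℕ, ∃ x' y' h', (3 ^ (n + 1) * 4 : ℕ) • P = Affine.Point.some x' y' h' ∧
      v x < v x' := by
    have step : ∀ m : ℕ, ∀ x' y' h', m • P = Affine.Point.some x' y' h' → 1 < v x' →
        ∃ x'' y'' h'', (3 * m : ℕ) • P = Affine.Point.some x'' y'' h'' ∧ v x' < v x'' := by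
      intro m x' y' h' e' hx'
      have hm0 : m • P ≠ 0 := by rw [e']; exact Affine.Point.some_ne_zero _
      have t2 := hne' m 2 hm0 hq2
      have t3 := hne' m 3 hm0 hq3
      rw [e'] at t2 t3
      obtain ⟨x3, y3, h3', e3, -, hd⟩ := EE_tpl h' t2 t3
      exact ⟨x3, y3, h3', by rw [mul_smul, e', e3], val_T v h3 hx' hd⟩
    intro n
    induction n with
    | zero => simpa using step 4 x y h e hx
    | succ n ih =>
      obtain ⟨x', y', h', e', hx'⟩ := ih
      obtain ⟨x'', y'', h'', e'', hx''⟩ := step _ x' y' h' e' (hx.trans hx')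
      refine ⟨x'', y'', h'', ?_, hx'.trans hx''⟩
      rw [← e'']
      congr 1
      ring
  have hcop : Nat.Coprime 3 q := ((Nat.coprime_primes Nat.prime_three hq).2 (Ne.symm case3))
  have hf := Nat.ModEq.pow_totient hcop
  rw [Nat.totient_prime hq] at hf
  obtain ⟨x', y', h', e', hx'⟩ := hind (q - 1 - 1)
  have hq1 : q - 1 - 1 + 1 = q - 1 := by have := hq.two_le; omega
  rw [hq1] at e'
  have : (3 ^ (q - 1) * 4 : ℕ) • P = (4 : ℕ) • P := by
    have := hf.mul_right 4
    rw [one_mul] at this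
    rw [← ho] at this
    exact nsmul_eq_nsmul_iff_modEq.2 (by rw [← ho]; exact this)
  rw [this, e] at e'
  have hxx : x = x' := by injection e'
  rw [hxx] at hx'
  exact lt_irrefl _ hx'

open scoped Classical in
/-- The elliptic curve `E : Y² = X³ + X + 1` has trivial torsion over any number field `K`
of degree at most `2` over `ℚ`: every point of `E(K)` of finite order (i.e. killed by some
positive integer) is the point at infinity. -/
theorem torsion_trivial_over_quadratic_field (K : Type*) [Field K] [NumberField K]
    (hdeg : Module.finrank ℚ K ≤ 2)
    (P : WeierstrassCurve.Affine.Point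
      (⟨0, 0, 0, (1 : K), (1 : K)⟩ : WeierstrassCurve.Affine K)) :
    (∃ k : ℕ, 1 ≤ k ∧ k • P = 0) → P = 0 := by
  rintro ⟨k, hk, hkP⟩
  by_contra hP
  have hfin : 0 < addOrderOf P :=
    addOrderOf_pos_iff.2 (isOfFinAddOrder_iff_nsmul_eq_zero.2 ⟨k, hk, hkP⟩)
  have h1 : addOrderOf P ≠ 1 := fun h => hP (AddMonoid.addOrderOf_eq_one_iff.1 h)
  obtain ⟨q, hq, m, hm⟩ := Nat.exists_prime_and_dvd h1
  refine torsion_aux K hdeg q hq (m • P) ?_ ?_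
  · intro h0
    have hd := addOrderOf_dvd_of_nsmul_eq_zero h0
    have hm0 : 0 < m := Nat.pos_of_ne_zero (by rintro rfl; simp [hm] at hfin)
    have hle := Nat.le_of_dvd hm0 hd
    have := hq.two_le
    nlinarith
  · rw [smul_smul, ← hm]
    exact addOrderOf_nsmul_eq_zero P
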